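/- arXiv:math/0605112 — 8 statements merged into one kernel-verified Lean document; each statement's English description precedes it below -/
import Mathlib

section
/- Let C be a preadditive category with a zero object, let I be a set (index type), and suppose C has all products and coproducts indexed by I. Assume there exist objects X, Y of C and a nonzero morphism f : X → Y. Then the coproduct functor ⨁ : C^I → C and the product functor ∏ : C^I → C are naturally isomorphic if and only if I is finite. -/
open CategoryTheory CategoryTheory.Limits

universe w v u

variable (C : Type u) [Category.{v} C] (I : Type w)

/-- The coproduct functor `C^I ⥤ C`, sending a family `(A_i)_{i ∈ I}` to `∐_{i ∈ I} A_i`. -/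
noncomputable def coproductFunctor [HasCoproductsOfShape I C] : (I → C) ⥤ C where
  obj A := ∐ A
  map {A B} f := Limits.Sigma.map f
  map_id A := by ext; simp [CategoryTheory.Pi.id_apply]
  map_comp f g := by ext; simp [CategoryTheory.Pi.comp_apply]

/-- The product functor `C^I ⥤ C`, sending a family `(A_i)_{i ∈ I}` to `∏_{i ∈ I} A_i`. -/
noncomputable def productFunctor [HasProductsOfShape I C] : (I → C) ⥤ C where
  obj A := ∏ᶜ A
  map {A B} f := Limits.Pi.map f
  map_id A := by ext; simp [CategoryTheory.Pi.id_apply]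
  map_comp f g := by ext; simp [CategoryTheory.Pi.comp_apply]

section

variable {C I}

open Classical in
lemma sigmaMap_single [HasZeroMorphisms C] [HasCoproductsOfShape I C] (A : I → C) (j : I) :
    Limits.Sigma.map (Pi.single j (𝟙 (A j)) : ∀ i, A i ⟶ A i) =
      Limits.Sigma.π A j ≫ Limits.Sigma.ι A j := by
  refine Limits.Sigma.hom_ext _ _ fun i => ?_
  rw [Limits.Sigma.ι_map]
  by_cases h : i = j
  · subst h; simp
  · rw [Limits.Sigma.ι_π_of_ne_assoc _ h, Pi.single_eq_of_ne h, zero_comp, zero_comp]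

open Classical in
lemma piMap_single [HasZeroMorphisms C] [HasProductsOfShape I C] (A : I → C) (j : I) :
    Limits.Pi.map (Pi.single j (𝟙 (A j)) : ∀ i, A i ⟶ A i) =
      Limits.Pi.π A j ≫ Limits.Pi.ι A j := by
  refine Limits.Pi.hom_ext _ _ fun i => ?_
  rw [Limits.Pi.map_π, Category.assoc]
  by_cases h : i = j
  · subst h; simp
  · rw [Limits.Pi.ι_π_of_ne _ (Ne.symm h), Pi.single_eq_of_ne h, comp_zero, comp_zero]

section Canonical

variable [HasZeroMorphisms C] [HasCoproductsOfShape I C] [HasProductsOfShape I C]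

open Classical in
/-- The canonical morphism `∐ A ⟶ ∏ᶜ A` given by the identity matrix. -/
noncomputable def coproductToProduct (A : I → C) : ∐ A ⟶ ∏ᶜ A :=
  Limits.Sigma.desc fun i => Limits.Pi.ι A i

open Classical in
lemma ι_coproductToProduct (A : I → C) (i : I) :
    Limits.Sigma.ι A i ≫ coproductToProduct A = Limits.Pi.ι A i :=
  Limits.Sigma.ι_desc _ _

lemma ι_coproductToProduct_π_self (A : I → C) (i : I) :
    Limits.Sigma.ι A i ≫ coproductToProduct A ≫ Limits.Pi.π A i = 𝟙 _ := by
  classical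
  rw [← Category.assoc, ι_coproductToProduct, Limits.Pi.ι_π_eq_id]

lemma ι_coproductToProduct_π_of_ne (A : I → C) {i j : I} (h : i ≠ j) :
    Limits.Sigma.ι A i ≫ coproductToProduct A ≫ Limits.Pi.π A j = 0 := by
  classical
  rw [← Category.assoc, ι_coproductToProduct, Limits.Pi.ι_π_of_ne _ h]

/-- The canonical natural transformation from the coproduct functor to the product functor. -/
noncomputable def coproductToProductNatTrans : coproductFunctor C I ⟶ productFunctor C I where
  app A := coproductToProduct A
  naturality A B f := by
    refine Limits.Sigma.hom_ext _ _ fun i => Limits.Pi.hom_ext _ _ fun j => ?_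
    change (Limits.Sigma.ι A i ≫ Limits.Sigma.map f ≫ coproductToProduct B) ≫ Limits.Pi.π B j =
      (Limits.Sigma.ι A i ≫ coproductToProduct A ≫ Limits.Pi.map f) ≫ Limits.Pi.π B j
    rw [Limits.Sigma.ι_map_assoc]
    simp only [Category.assoc, Limits.Pi.map_π]
    by_cases h : i = j
    · subst h
      have hA := ι_coproductToProduct_π_self A i =≫ f i
      simp only [Category.assoc] at hA
      rw [hA, ι_coproductToProduct_π_self, Category.comp_id, Category.id_comp]
    · have hA := ι_coproductToProduct_π_of_ne A h =≫ f j
      simp only [Category.assoc] at hA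
      rw [hA, ι_coproductToProduct_π_of_ne _ h, comp_zero, zero_comp]

/-- If the coproduct and product functors are naturally isomorphic in any way, then the canonical
morphism is an isomorphism. -/
lemma isIso_coproductToProduct_of_iso (e : coproductFunctor C I ≅ productFunctor C I)
    (A : I → C) : IsIso (coproductToProduct A) := by
  classical
  let φ : ∐ A ⟶ ∏ᶜ A := e.hom.app A
  let ψ : ∏ᶜ A ⟶ ∐ A := e.inv.app A
  have hφψ : φ ≫ ψ = 𝟙 _ := e.hom_inv_id_app A
  have hψφ : ψ ≫ φ = 𝟙 _ := e.inv_hom_id_app A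
  have nat (j : I) : (Limits.Sigma.π A j ≫ Limits.Sigma.ι A j) ≫ φ =
      φ ≫ Limits.Pi.π A j ≫ Limits.Pi.ι A j := by
    rw [← sigmaMap_single, ← piMap_single]
    exact e.hom.naturality (X := A) (Y := A) (Pi.single j (𝟙 (A j)) : ∀ i, A i ⟶ A i)
  let u (j : I) : A j ⟶ A j := Limits.Sigma.ι A j ≫ φ ≫ Limits.Pi.π A j
  have hu (j : I) : IsIso (u j) := by
    refine ⟨Limits.Pi.ι A j ≫ ψ ≫ Limits.Sigma.π A j, ?_, ?_⟩
    · have := (nat j).symm =≫ ψ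
      simp only [Category.assoc, hφψ, Category.comp_id] at this
      simp only [u, Category.assoc]
      have h2 := Limits.Sigma.ι A j ≫= this =≫ Limits.Sigma.π A j
      simpa using h2
    · have := ψ ≫= nat j
      rw [← Category.assoc ψ φ, hψφ, Category.id_comp] at this
      have h2 := Limits.Pi.ι A j ≫= this =≫ Limits.Pi.π A j
      simpa [u] using h2
  have key : φ = Limits.Sigma.map u ≫ coproductToProduct A := by
    refine Limits.Sigma.hom_ext _ _ fun i => Limits.Pi.hom_ext _ _ fun j => ?_
    rw [Limits.Sigma.ι_map_assoc]
    simp only [Category.assoc]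
    by_cases h : i = j
    · subst h
      rw [ι_coproductToProduct_π_self, Category.comp_id]
    · rw [ι_coproductToProduct_π_of_ne _ h, comp_zero]
      have h2 := Limits.Sigma.ι A i ≫= nat j =≫ Limits.Pi.π A j
      simp only [Category.assoc, Limits.Pi.ι_π_eq_id, Category.comp_id,
        Limits.Sigma.ι_π_of_ne_assoc _ h, zero_comp] at h2
      exact h2.symm
  have : IsIso φ := ⟨ψ, hφψ, hψφ⟩
  have : IsIso (Limits.Sigma.map u ≫ coproductToProduct A) := key ▸ this
  exact IsIso.of_isIso_comp_left (Limits.Sigma.map u) _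

end Canonical

variable [Preadditive C] [HasCoproductsOfShape I C] [HasProductsOfShape I C]

lemma isIso_coproductToProduct_of_finite [Finite I] (A : I → C) :
    IsIso (coproductToProduct A) := by
  classical
  have : HasBiproduct A := HasBiproduct.of_hasProduct A
  have h : coproductToProduct A =
      (biproduct.isoCoproduct A).inv ≫ (biproduct.isoProduct A).hom := by
    refine Limits.Sigma.hom_ext _ _ fun i => Limits.Pi.hom_ext _ _ fun j => ?_
    rw [ι_coproductToProduct, Limits.Pi.ι_π]
    simp [biproduct.ι_π]
  rw [h]
  infer_instance

section InfiniteSum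

variable {X Y : C}

/-- The sum of an arbitrary `I`-indexed family of parallel morphisms, available when the canonical
morphism from the copower to the power is invertible. -/
noncomputable def homSum [IsIso (coproductToProduct fun _ : I => Y)] (g : I → (X ⟶ Y)) : X ⟶ Y :=
  Limits.Pi.lift g ≫ inv (coproductToProduct fun _ : I => Y) ≫ Limits.Sigma.desc fun _ => 𝟙 Y

variable [IsIso (coproductToProduct fun _ : I => Y)]

lemma homSum_add (g h : I → (X ⟶ Y)) : homSum (g + h) = homSum g + homSum h := by
  have : Limits.Pi.lift (g + h) = Limits.Pi.lift g + Limits.Pi.lift h :=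
    Limits.Pi.hom_ext _ _ fun i => by simp [Preadditive.add_comp]
  simp only [homSum, this, Preadditive.add_comp]

/-- A lift through the copower computes the sum. -/
lemma homSum_eq {g : I → (X ⟶ Y)} (h : X ⟶ ∐ fun _ : I => Y)
    (hg : ∀ i, h ≫ coproductToProduct (fun _ : I => Y) ≫ Limits.Pi.π _ i = g i) :
    homSum g = h ≫ Limits.Sigma.desc fun _ => 𝟙 Y := by
  have : Limits.Pi.lift g = h ≫ coproductToProduct (fun _ : I => Y) :=
    Limits.Pi.hom_ext _ _ fun i => by simp [hg]
  simp [homSum, this]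

open Classical in
lemma homSum_single (i : I) (f : X ⟶ Y) : homSum (Pi.single i f) = f := by
  rw [homSum_eq (f ≫ Limits.Sigma.ι (fun _ : I => Y) i) fun j => ?_]
  · simp
  · rw [Category.assoc]
    by_cases h : i = j
    · subst h
      rw [ι_coproductToProduct_π_self, Pi.single_eq_same, Category.comp_id]
    · rw [ι_coproductToProduct_π_of_ne _ h, Pi.single_eq_of_ne (Ne.symm h), comp_zero]

/-- Extending a family by zero along an injection does not change its sum. -/
lemma homSum_extend {s : I → I} (hs : Function.Injective s) (g : I → (X ⟶ Y)) :
    homSum (Function.extend s g 0) = homSum g := by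
  let r : (∐ fun _ : I => Y) ⟶ ∐ fun _ : I => Y :=
    Limits.Sigma.desc fun i => Limits.Sigma.ι (fun _ : I => Y) (s i)
  rw [homSum_eq (Limits.Pi.lift g ≫ inv (coproductToProduct fun _ : I => Y) ≫ r) fun k => ?_]
  · have : r ≫ (Limits.Sigma.desc fun _ => 𝟙 Y) = Limits.Sigma.desc fun _ => 𝟙 Y :=
      Limits.Sigma.hom_ext _ _ fun i => by simp [r]
    simp [homSum, this]
  · by_cases hk : ∃ i, s i = k
    · obtain ⟨i, rfl⟩ := hk
      have : r ≫ coproductToProduct (fun _ : I => Y) ≫ Limits.Pi.π _ (s i) =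
          coproductToProduct (fun _ : I => Y) ≫ Limits.Pi.π _ i := by
        refine Limits.Sigma.hom_ext _ _ fun j => ?_
        simp only [r, Limits.Sigma.ι_desc_assoc]
        by_cases h : j = i
        · subst h
          rw [ι_coproductToProduct_π_self, ι_coproductToProduct_π_self]
        · rw [ι_coproductToProduct_π_of_ne _ h, ι_coproductToProduct_π_of_ne _ (hs.ne h)]
      simp [this, hs.extend_apply]
    · have : r ≫ coproductToProduct (fun _ : I => Y) ≫ Limits.Pi.π _ k = 0 := by
        refine Limits.Sigma.hom_ext _ _ fun j => ?_
        simp only [r, Limits.Sigma.ι_desc_assoc]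
        rw [ι_coproductToProduct_π_of_ne _ fun h => hk ⟨j, h⟩, comp_zero]
      simp [this, Function.extend_apply' _ _ _ hk]

/-- The Eilenberg swindle: infinite sums of morphisms force every morphism to vanish. -/
lemma eq_zero_of_isIso_coproductToProduct [Infinite I] (f : X ⟶ Y) : f = 0 := by
  classical
  obtain ⟨e⟩ : Nonempty (Option I ≃ I) := by
    rw [← Cardinal.eq, Cardinal.mk_option, Cardinal.add_one_eq (Cardinal.aleph0_le_mk I)]
  have hs : Function.Injective (e ∘ some) := e.injective.comp (Option.some_injective I)
  have h : (fun _ => f : I → (X ⟶ Y)) =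
      Function.extend (e ∘ some) (fun _ => f) 0 + Pi.single (e none) f := by
    funext k
    obtain ⟨_ | i, rfl⟩ := e.surjective k
    · rw [Pi.add_apply, Function.extend_apply' _ _ _ (by simp)]
      simp
    · have h1 := hs.extend_apply (fun _ => f) (0 : I → (X ⟶ Y)) i
      rw [Function.comp_apply] at h1
      rw [Pi.add_apply, h1, Pi.single_eq_of_ne (by simp), add_zero]
  have h2 := congrArg homSum h
  rwa [homSum_add, homSum_extend hs, homSum_single, left_eq_add] at h2

end InfiniteSum

end

/-- In a preadditive category with a zero object having `I`-indexed products and coproducts,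
if there is a nonzero morphism `f : X ⟶ Y`, then the coproduct functor and the product functor
`C^I ⥤ C` are naturally isomorphic if and only if `I` is finite. -/
theorem coproductFunctor_iso_productFunctor_iff_finite
    [Preadditive C] [HasZeroObject C]
    [HasCoproductsOfShape I C] [HasProductsOfShape I C]
    (X Y : C) (f : X ⟶ Y) (hf : f ≠ 0) :
    Nonempty (coproductFunctor C I ≅ productFunctor C I) ↔ Finite I := by
  constructor
  · rintro ⟨e⟩
    by_contra hI
    have : Infinite I := not_finite_iff_infinite.mp hI
    have := isIso_coproductToProduct_of_iso e fun _ => Y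
    exact hf (eq_zero_of_isIso_coproductToProduct (I := I) f)
  · intro _
    have (A : I → C) : IsIso ((coproductToProductNatTrans (C := C) (I := I)).app A) :=
      isIso_coproductToProduct_of_finite A
    have := NatIso.isIso_of_isIso_app (coproductToProductNatTrans (C := C) (I := I))
    exact ⟨asIso coproductToProductNatTrans⟩
end

section
/- Let R be a nontrivial ring and I a set. The product functor ∏ and the coproduct (direct sum) functor ⨁ from (ModuleCat R)^I to ModuleCat R are naturally isomorphic if and only if I is finite. -/
open CategoryTheory CategoryTheory.Limits

universe w v u

variable (C : Type u) [Category.{v} C] (I : Type w)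

/-- The endomorphism of the family `A` that is the identity at `j` and zero elsewhere. -/
noncomputable def familyProj [HasZeroMorphisms C] (A : I → C) (j : I) : A ⟶ A :=
  open Classical in fun i => if i = j then 𝟙 (A i) else 0

/-- An element of a coproduct of modules is killed by all but finitely many projections. -/
lemma finite_sigmaMap_familyProj_ne_zero {R : Type u} [Ring R] {J : Type v}
    (A : J → ModuleCat.{max u v} R) (y : (∐ A : ModuleCat.{max u v} R)) :
    {j | (Limits.Sigma.map (familyProj (ModuleCat.{max u v} R) J A j)).hom y ≠ 0}.Finite := by
  classical
  obtain ⟨d, rfl⟩ : ∃ d, (ModuleCat.coprodIsoDirectSum A).inv.hom d = y :=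
    ⟨(ModuleCat.coprodIsoDirectSum A).hom.hom y,
      ConcreteCategory.congr_hom (ModuleCat.coprodIsoDirectSum A).hom_inv_id y⟩
  induction d using DirectSum.induction_on with
  | zero => simp
  | of i a =>
    refine (Set.finite_singleton i).subset fun j hj => ?_
    by_contra hji
    apply hj
    have hcomp : ModuleCat.ofHom (DirectSum.lof R J (fun i => A i) i) ≫
        (ModuleCat.coprodIsoDirectSum A).inv ≫
          Limits.Sigma.map (familyProj (ModuleCat.{max u v} R) J A j) = 0 := by
      rw [← Category.assoc, ModuleCat.lof_coprodIsoDirectSum_inv]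
      simp [familyProj, show i ≠ j from fun h => hji h.symm]
    exact ConcreteCategory.congr_hom hcomp a
  | add x y hx hy =>
    refine (hx.union hy).subset fun j hj => ?_
    by_contra h
    simp only [Set.mem_union, Set.mem_ofPred_eq, not_or, not_not] at h
    exact hj (by rw [map_add, map_add, h.1, h.2, add_zero])

/-- For a nontrivial ring `R` and a set `I`, the coproduct (direct sum) functor and the
product functor `(ModuleCat R)^I ⥤ ModuleCat R` are naturally isomorphic if and only if
`I` is finite. -/
theorem moduleCat_coproductFunctor_iso_productFunctor_iff_finite
    (R : Type u) [Ring R] [Nontrivial R] (J : Type v) :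
    Nonempty (coproductFunctor (ModuleCat.{max u v} R) J ≅
      productFunctor (ModuleCat.{max u v} R) J) ↔ Finite J := by
  refine ⟨fun ⟨α⟩ => ?_, fun _ => ?_⟩
  · let A : J → ModuleCat.{max u v} R := fun _ => ModuleCat.of R (ULift.{max u v} R)
    obtain ⟨x, hx⟩ : ∃ x : (∏ᶜ A : ModuleCat.{max u v} R),
        ∀ j, (Limits.Pi.π A j).hom x = ULift.up 1 :=
      ⟨(Limits.Pi.lift fun j => 𝟙 (A j)).hom (ULift.up 1), fun j =>
        ConcreteCategory.congr_hom (Limits.Pi.lift_π (fun j => 𝟙 (A j)) j) (ULift.up 1)⟩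
    refine Set.finite_univ_iff.mp
      ((finite_sigmaMap_familyProj_ne_zero A ((α.inv.app A).hom x)).subset fun j _ hj => ?_)
    have hnat := ConcreteCategory.congr_hom
      (α.inv.naturality (familyProj (ModuleCat.{max u v} R) J A j)) x
    have hmap : (Limits.Pi.map (familyProj (ModuleCat.{max u v} R) J A j)).hom x = 0 := by
      have hinj : Function.Injective (α.inv.app A).hom :=
        (α.app A).symm.toLinearEquiv.injective
      exact hinj ((hnat.trans hj).trans (map_zero _).symm)
    have hπ := ConcreteCategory.congr_hom
      (Limits.Pi.map_π (familyProj (ModuleCat.{max u v} R) J A j) j) x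
    have hone : (ULift.up 1 : ULift.{max u v} R) = 0 := by
      have hproj : familyProj (ModuleCat.{max u v} R) J A j j = 𝟙 (A j) := by simp [familyProj]
      rw [hproj, Category.comp_id] at hπ
      exact (hx j).symm.trans (hπ.symm.trans ((congrArg (Limits.Pi.π A j).hom hmap).trans
        (map_zero (Limits.Pi.π A j).hom)))
    exact one_ne_zero (congrArg ULift.down hone)
  · exact ⟨NatIso.ofComponents
      (fun A => (biproduct.isoCoproduct A).symm ≪≫ biproduct.isoProduct A) fun {A B} f => by
        dsimp [coproductFunctor, productFunctor]
        ext i j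
        by_cases h : i = j
        · subst h; simp
        · simp [h]⟩
end

section
/- Let C be a category with a zero object (hence with zero morphisms), let I be a set, and suppose C has all products and coproducts indexed by I. If the coproduct functor ⨁ : C^I → C and the product functor ∏ : C^I → C are naturally isomorphic, then the canonical natural transformation from ⨁ to ∏ is a natural isomorphism. -/
open CategoryTheory CategoryTheory.Limits

universe w v u

variable (C : Type u) [Category.{v} C] (I : Type w)

variable [DecidableEq I] [HasZeroMorphisms C] [HasCoproductsOfShape I C] [HasProductsOfShape I C]

/-- The canonical morphism from the coproduct to the product of a family `A`,
whose `(k, l)` component is the identity of `A_k` if `k = l` and zero otherwise. -/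
noncomputable def canonicalHom (A : I → C) : (∐ A) ⟶ ∏ᶜ A :=
  Limits.Sigma.desc fun k => Limits.Pi.lift fun l =>
    if h : k = l then eqToHom (congrArg A h) else 0

/-- The canonical natural transformation from the coproduct functor to the product functor. -/
noncomputable def canonicalNatTrans : coproductFunctor C I ⟶ productFunctor C I where
  app A := canonicalHom C I A
  naturality {A B} f := by
    dsimp [coproductFunctor, productFunctor]
    apply Limits.Sigma.hom_ext
    intro k
    apply Limits.Pi.hom_ext
    intro l
    by_cases h : k = l
    · subst h
      simp [canonicalHom]
    · simp [canonicalHom, h]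

section Concentrated

variable {C I}

omit [HasProductsOfShape I C] in
lemma isIso_sigma_ι_of_isZero (B : I → C) (k : I) (hB : ∀ j, j ≠ k → IsZero (B j)) :
    IsIso (Sigma.ι B k) := by
  refine ⟨Sigma.desc fun j => if h : j = k then eqToHom (congrArg B h) else 0, by simp, ?_⟩
  refine Sigma.hom_ext _ _ fun j => ?_
  by_cases h : j = k
  · subst h
    simp
  · exact (hB j h).eq_of_src _ _

omit [HasCoproductsOfShape I C] in
lemma isIso_pi_π_of_isZero (B : I → C) (k : I) (hB : ∀ j, j ≠ k → IsZero (B j)) :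
    IsIso (Pi.π B k) := by
  refine ⟨Pi.lift fun j => if h : k = j then eqToHom (congrArg B h) else 0, ?_, by simp⟩
  refine Pi.hom_ext _ _ fun j => ?_
  by_cases h : k = j
  · subst h
    simp
  · exact (hB j (Ne.symm h)).eq_of_tgt _ _

omit [HasCoproductsOfShape I C] [HasProductsOfShape I C] in
/-- The inclusion into `A` of the family equal to `A k` at `k` and zero elsewhere. -/
lemma exists_concentrated_family [HasZeroObject C] (A : I → C) (k : I) :
    ∃ (B : I → C) (f : B ⟶ A), (∀ j, j ≠ k → IsZero (B j)) ∧ IsIso (f k) := by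
  obtain ⟨Z, hZ⟩ := HasZeroObject.zero (C := C)
  refine ⟨fun j => if j = k then A j else Z,
    fun j => if h : j = k then eqToHom (if_pos h) else 0, fun j hj => ?_, ?_⟩
  · simpa [hj] using hZ
  · simp only [dite_true]
    infer_instance

omit [DecidableEq I] [HasZeroMorphisms C] in
lemma ι_natTrans_app_π (ψ : coproductFunctor C I ⟶ productFunctor C I) {A B : I → C}
    (f : B ⟶ A) (k l : I) :
    f k ≫ Sigma.ι A k ≫ ψ.app A ≫ Pi.π A l = Sigma.ι B k ≫ ψ.app B ≫ Pi.π B l ≫ f l := by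
  have h := Sigma.ι B k ≫= ψ.naturality f =≫ Pi.π A l
  simpa [coproductFunctor, productFunctor] using h

lemma ι_natTrans_app_π_of_ne [HasZeroObject C]
    (ψ : coproductFunctor C I ⟶ productFunctor C I) (A : I → C) {k l : I} (hkl : k ≠ l) :
    Sigma.ι A k ≫ ψ.app A ≫ Pi.π A l = 0 := by
  obtain ⟨B, f, hB, hf⟩ := exists_concentrated_family A k
  rw [← cancel_epi (f k), ι_natTrans_app_π, (hB l hkl.symm).eq_of_src (f l) 0]
  simp [coproductFunctor, productFunctor]

lemma isIso_ι_natTrans_app_π [HasZeroObject C]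
    (ψ : coproductFunctor C I ≅ productFunctor C I) (A : I → C) (k : I) :
    IsIso (Sigma.ι A k ≫ ψ.hom.app A ≫ Pi.π A k) := by
  obtain ⟨B, f, hB, hf⟩ := exists_concentrated_family A k
  have hι : IsIso (Sigma.ι B k) := isIso_sigma_ι_of_isZero B k hB
  have hπ : IsIso (Pi.π B k) := isIso_pi_π_of_isZero B k hB
  have hψ : IsIso (Sigma.ι B k ≫ ψ.hom.app B ≫ Pi.π B k ≫ f k) := by
    have h₁ : IsIso (Pi.π B k ≫ f k) := inferInstance
    have h₂ : IsIso (ψ.hom.app B ≫ Pi.π B k ≫ f k) :=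
      IsIso.comp_isIso' (inferInstance : IsIso (ψ.hom.app B)) h₁
    exact IsIso.comp_isIso' hι h₂
  rw [← ι_natTrans_app_π] at hψ
  exact IsIso.of_isIso_comp_left (f k) _

lemma canonicalHom_comp_map_diagonal [HasZeroObject C]
    (ψ : coproductFunctor C I ⟶ productFunctor C I) (A : I → C) :
    canonicalHom C I A ≫ Limits.Pi.map (fun k => Sigma.ι A k ≫ ψ.app A ≫ Pi.π A k) =
      ψ.app A := by
  refine Sigma.hom_ext _ _ fun k => Pi.hom_ext _ _ fun l => ?_
  by_cases h : k = l
  · subst h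
    simp only [canonicalHom, colimit.ι_desc_assoc, Cofan.mk_ι_app, Category.assoc, Pi.map_π,
      limit.lift_π_assoc, Fan.mk_π_app, dite_true, eqToHom_refl]
    exact (Category.id_comp _).trans (Category.assoc (Sigma.ι A k) (ψ.app A) (Pi.π A k)).symm
  · simp only [canonicalHom, colimit.ι_desc_assoc, Cofan.mk_ι_app, Category.assoc, Pi.map_π,
      limit.lift_π_assoc, Fan.mk_π_app, h, dite_false, zero_comp]
    exact ((Category.assoc _ _ _).trans (ι_natTrans_app_π_of_ne ψ A h)).symm

end Concentrated

/-- If the coproduct functor and the product functor `C^I ⥤ C` are naturally isomorphic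
(for a category `C` with a zero object), then the canonical natural transformation from the
coproduct functor to the product functor is a natural isomorphism. -/
theorem isIso_canonicalNatTrans_of_iso [HasZeroObject C]
    (h : Nonempty (coproductFunctor C I ≅ productFunctor C I)) :
    IsIso (canonicalNatTrans C I) := by
  obtain ⟨ψ⟩ := h
  rw [NatTrans.isIso_iff_isIso_app]
  intro A
  have hdiag := isIso_ι_natTrans_app_π ψ A
  have hcomp : IsIso (canonicalHom C I A ≫
      Limits.Pi.map (fun k => Sigma.ι A k ≫ ψ.hom.app A ≫ Pi.π A k)) := by
    rw [canonicalHom_comp_map_diagonal]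
    exact (inferInstance : IsIso (ψ.hom.app A))
  exact IsIso.of_isIso_comp_right (canonicalHom C I A)
    (Limits.Pi.map fun k => Sigma.ι A k ≫ ψ.hom.app A ≫ Pi.π A k)
end

section
/- Let C be a preadditive category with a zero object, let I be an infinite set, and suppose C has all products and coproducts indexed by sets of cardinality at most that of I (in particular ℕ-indexed ones). If the canonical natural transformation from the coproduct functor ⨁ : C^I → C to the product functor ∏ : C^I → C is a natural isomorphism, then every morphism in C is zero (equivalently, every object of C is a zero object). -/
open CategoryTheory CategoryTheory.Limits

universe w v u

variable (C : Type u) [Category.{v} C] (I : Type w)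

variable [DecidableEq I] [HasZeroMorphisms C] [HasCoproductsOfShape I C] [HasProductsOfShape I C]

/-- The components of the canonical morphism of a constant family. -/
theorem ι_canonicalHom_const_π (X : C) (k l : I) :
    Limits.Sigma.ι (fun _ : I => X) k ≫ canonicalHom C I (fun _ => X) ≫
      Limits.Pi.π (fun _ : I => X) l = if k = l then 𝟙 X else 0 := by
  simp [canonicalHom]

/-- Shifting along a bijection `Option I ≃ I` commutes with the canonical morphism. -/
theorem canonicalHom_const_shift (X : C) (e : Option I ≃ I) :
    canonicalHom C I (fun _ => X) ≫
      Limits.Pi.lift (fun j => (e.symm j).elim 0 (Limits.Pi.π (fun _ : I => X))) =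
    Limits.Sigma.desc (fun k => Limits.Sigma.ι (fun _ : I => X) (e (some k))) ≫
      canonicalHom C I (fun _ => X) := by
  apply Limits.Sigma.hom_ext
  intro k
  apply Limits.Pi.hom_ext
  intro j
  obtain ⟨o, rfl⟩ := e.surjective j
  cases o <;> simp [ι_canonicalHom_const_π]

/-- An object is zero if the canonical morphism of its constant family is invertible: the sum of
infinitely many copies of its identity absorbs one more copy. -/
theorem id_eq_zero_of_isIso_canonicalHom_const [Preadditive C] [Infinite I] (X : C)
    [IsIso (canonicalHom C I (fun _ => X))] : 𝟙 X = 0 := by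
  obtain rfl : ‹HasZeroMorphisms C› = Preadditive.preadditiveHasZeroMorphisms :=
    Subsingleton.elim _ _
  obtain ⟨e⟩ : Nonempty (Option I ≃ I) := by
    rw [← Cardinal.eq, Cardinal.mk_option]
    exact Cardinal.add_one_eq (Cardinal.aleph0_le_mk I)
  let diag : X ⟶ ∏ᶜ fun _ : I => X := Limits.Pi.lift fun _ => 𝟙 X
  let shift : (∏ᶜ fun _ : I => X) ⟶ ∏ᶜ fun _ : I => X :=
    Limits.Pi.lift fun j => (e.symm j).elim 0 (Limits.Pi.π (fun _ : I => X))
  let codiag : (∐ fun _ : I => X) ⟶ X := Limits.Sigma.desc fun _ => 𝟙 X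
  let total := inv (canonicalHom C I (fun _ => X)) ≫ codiag
  have diag_eq : diag = Limits.Sigma.ι (fun _ : I => X) (e none) ≫
      canonicalHom C I (fun _ => X) + diag ≫ shift := by
    apply Limits.Pi.hom_ext
    intro j
    obtain ⟨o, rfl⟩ := e.surjective j
    cases o <;> simp [diag, shift, ι_canonicalHom_const_π]
  have shift_total : shift ≫ total = total := by
    rw [← cancel_epi (canonicalHom C I (fun _ => X))]
    simp only [total, shift, reassoc_of% canonicalHom_const_shift C I X e, IsIso.hom_inv_id_assoc]
    apply Limits.Sigma.hom_ext
    intro k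
    simp [codiag]
  have absorb : diag ≫ total = 𝟙 X + diag ≫ total := by
    conv_lhs => rw [diag_eq]
    rw [Preadditive.add_comp, Category.assoc, Category.assoc, shift_total]
    simp [total, codiag]
  simpa using absorb

/-- Let `C` be a preadditive category with a zero object, and `I` an infinite set, such that
`C` has products and coproducts indexed by `I` (and, in particular, by `ℕ`). If the canonical
natural transformation from the coproduct functor to the product functor `C^I ⥤ C` is a natural
isomorphism, then every morphism of `C` is zero. -/
theorem eq_zero_of_isIso_canonicalNatTrans [Preadditive C] [HasZeroObject C] [Infinite I]
    [HasCoproductsOfShape ℕ C] [HasProductsOfShape ℕ C]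
    (h : IsIso (canonicalNatTrans C I)) :
    ∀ (X Y : C) (f : X ⟶ Y), f = 0 := by
  intro X Y f
  have : IsIso (canonicalHom C I (fun _ => X)) :=
    inferInstanceAs (IsIso ((canonicalNatTrans C I).app fun _ => X))
  rw [← Category.id_comp f, id_eq_zero_of_isIso_canonicalHom_const C I X, zero_comp]
end

section
/- Let C be a category with a zero object, let I be a set, and suppose C has all products and coproducts indexed by I. Let Θ be any natural transformation from the coproduct functor ⨁ : C^I → C to the product functor ∏ : C^I → C. Then for every family A = (A_i)_{i∈I} in C^I and all k, l ∈ I with k ≠ l, the composite π_l ∘ Θ_A ∘ ι_k : A_k → A_l is the zero morphism, where ι_k is the k-th coproduct injection and π_l is the l-th product projection. -/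
open CategoryTheory CategoryTheory.Limits

universe w v u

variable (C : Type u) [Category.{v} C] (I : Type w)

/-- A morphism from a coproduct to a product which commutes with the maps induced by all families
of endomorphisms has vanishing off-diagonal components. -/
theorem ι_comp_π_eq_zero_of_commutes {C : Type u} [Category.{v} C] {I : Type w}
    [HasZeroMorphisms C] {A : I → C} [HasCoproduct A] [HasProduct A] (θ : ∐ A ⟶ ∏ᶜ A)
    (hθ : ∀ f : ∀ i, A i ⟶ A i, Limits.Sigma.map f ≫ θ = θ ≫ Limits.Pi.map f)
    {k l : I} (hkl : k ≠ l) :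
    Limits.Sigma.ι A k ≫ θ ≫ Limits.Pi.π A l = 0 := by
  classical
  let f : ∀ i, A i ⟶ A i := fun i => if i = k then 𝟙 (A i) else 0
  have hk : f k = 𝟙 (A k) := if_pos rfl
  have hl : f l = 0 := if_neg hkl.symm
  calc Limits.Sigma.ι A k ≫ θ ≫ Limits.Pi.π A l
      = Limits.Sigma.ι A k ≫ (Limits.Sigma.map f ≫ θ) ≫ Limits.Pi.π A l := by simp [hk]
    _ = Limits.Sigma.ι A k ≫ (θ ≫ Limits.Pi.map f) ≫ Limits.Pi.π A l := by rw [hθ]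
    _ = 0 := by simp [hl]

/-- For any natural transformation `Θ` from the coproduct functor to the product functor
`C^I ⥤ C` (where `C` has a zero object), the off-diagonal components
`π_l ∘ Θ_A ∘ ι_k` (for `k ≠ l`) vanish. -/
theorem offDiagonal_component_eq_zero [HasZeroObject C] [HasZeroMorphisms C]
    [HasCoproductsOfShape I C] [HasProductsOfShape I C]
    (Θ : coproductFunctor C I ⟶ productFunctor C I)
    (A : I → C) (k l : I) (hkl : k ≠ l) :
    Limits.Sigma.ι A k ≫ Θ.app A ≫ Limits.Pi.π A l = 0 := by
  exact ι_comp_π_eq_zero_of_commutes (Θ.app A) (fun f => Θ.naturality (X := A) (Y := A) f) hkl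
end

section
/- Let C be a category with a zero object, let I be an infinite set, and suppose C has all products and coproducts indexed by sets of cardinality at most that of I (in particular ℕ-indexed ones). If the coproduct functor ⨁ : C^I → C and the product functor ∏ : C^I → C are naturally isomorphic, then for every object X of C the canonical morphism from the coproduct ∐_{n∈ℕ} X of countably many copies of X to the product ∏_{n∈ℕ} X is an isomorphism. -/
open CategoryTheory CategoryTheory.Limits

universe w v u

variable (C : Type u) [Category.{v} C] (I : Type w)

variable [DecidableEq I] [HasZeroMorphisms C] [HasCoproductsOfShape I C] [HasProductsOfShape I C]

/-- The canonical morphism from an `ℕ`-indexed coproduct to the corresponding product. -/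
noncomputable def canonicalHomNat [HasCoproductsOfShape ℕ C] [HasProductsOfShape ℕ C]
    (A : ℕ → C) : (∐ A) ⟶ ∏ᶜ A :=
  Limits.Sigma.desc fun k => Limits.Pi.lift fun l =>
    if h : k = l then eqToHom (congrArg A h) else 0

/-- The endomorphism of the family `A` that is the identity at `k` and zero elsewhere. -/
noncomputable def familyIdempotent {C : Type u} [Category.{v} C] {I : Type w} [DecidableEq I]
    [HasZeroMorphisms C] (A : I → C) (k : I) : A ⟶ A :=
  fun l => if l = k then 𝟙 (A l) else 0

lemma coproductFunctor_map_familyIdempotent {C : Type u} [Category.{v} C] {I : Type w}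
    [DecidableEq I] [HasZeroMorphisms C] [HasCoproductsOfShape I C] (A : I → C) (k : I) :
    (coproductFunctor C I).map (familyIdempotent A k) = Sigma.π A k ≫ Sigma.ι A k := by
  apply Limits.Sigma.hom_ext
  intro l
  by_cases h : l = k
  · subst h
    simp [coproductFunctor, familyIdempotent]
  · simp [coproductFunctor, familyIdempotent, h, Sigma.ι_π_of_ne_assoc]

lemma productFunctor_map_familyIdempotent {C : Type u} [Category.{v} C] {I : Type w}
    [DecidableEq I] [HasZeroMorphisms C] [HasProductsOfShape I C] (A : I → C) (k : I) :
    (productFunctor C I).map (familyIdempotent A k) = Pi.π A k ≫ Pi.ι A k := by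
  apply Limits.Pi.hom_ext
  intro l
  by_cases h : l = k
  · subst h
    simp [productFunctor, familyIdempotent]
  · simp [productFunctor, familyIdempotent, h, Pi.ι_π_of_ne _ (Ne.symm h)]

section

variable {C I}

@[simp]
lemma ι_canonicalHom_π_self (A : I → C) (k : I) :
    Sigma.ι A k ≫ canonicalHom C I A ≫ Pi.π A k = 𝟙 (A k) := by
  simp [canonicalHom]

lemma ι_canonicalHom_π_of_ne (A : I → C) {k l : I} (h : k ≠ l) :
    Sigma.ι A k ≫ canonicalHom C I A ≫ Pi.π A l = 0 := by
  simp [canonicalHom, h]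

/-- A natural transformation from the coproduct to the product functor commutes with the
projection-inclusion idempotents. -/
lemma π_ι_comp_natTrans_app (φ : coproductFunctor C I ⟶ productFunctor C I) (A : I → C)
    {f : ∐ A ⟶ ∏ᶜ A} (hf : φ.app A = f) (k : I) :
    Sigma.π A k ≫ Sigma.ι A k ≫ f = f ≫ Pi.π A k ≫ Pi.ι A k := by
  subst hf
  have h := φ.naturality (familyIdempotent A k)
  rw [productFunctor_map_familyIdempotent, coproductFunctor_map_familyIdempotent] at h
  exact (Category.assoc _ _ _).symm.trans h

section

variable {A : I → C}

lemma ι_comp_π_of_ne {f : ∐ A ⟶ ∏ᶜ A}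
    (hf : ∀ k, Sigma.π A k ≫ Sigma.ι A k ≫ f = f ≫ Pi.π A k ≫ Pi.ι A k)
    {k l : I} (h : k ≠ l) : Sigma.ι A k ≫ f ≫ Pi.π A l = 0 := by
  have := Sigma.ι A k ≫= hf k =≫ Pi.π A l
  simpa [Pi.ι_π_of_ne _ h] using this

/-- The diagonal components of an isomorphism from the coproduct to the product that commutes with
the projection-inclusion idempotents, as automorphisms of the members of the family. -/
@[simps]
noncomputable def diagonalIso (f : ∐ A ≅ ∏ᶜ A)
    (hf : ∀ k, Sigma.π A k ≫ Sigma.ι A k ≫ f.hom = f.hom ≫ Pi.π A k ≫ Pi.ι A k) (k : I) :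
    A k ≅ A k where
  hom := Sigma.ι A k ≫ f.hom ≫ Pi.π A k
  inv := Pi.ι A k ≫ f.inv ≫ Sigma.π A k
  hom_inv_id := by
    have := Sigma.ι A k ≫= hf k =≫ (f.inv ≫ Sigma.π A k)
    simpa using this.symm
  inv_hom_id := by
    have := (Pi.ι A k ≫ f.inv) ≫= hf k =≫ Pi.π A k
    simpa using this

lemma mapIso_diagonalIso_comp_canonicalHom (f : ∐ A ≅ ∏ᶜ A)
    (hf : ∀ k, Sigma.π A k ≫ Sigma.ι A k ≫ f.hom = f.hom ≫ Pi.π A k ≫ Pi.ι A k) :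
    (Sigma.mapIso (diagonalIso f hf)).hom ≫ canonicalHom C I A = f.hom := by
  apply Limits.Sigma.hom_ext
  intro k
  apply Limits.Pi.hom_ext
  intro l
  by_cases h : k = l
  · subst h
    simp
  · simp [ι_canonicalHom_π_of_ne _ h, ι_comp_π_of_ne hf h]

end

lemma isIso_canonicalHom_of_iso (φ : coproductFunctor C I ≅ productFunctor C I) (A : I → C) :
    IsIso (canonicalHom C I A) := by
  let f : ∐ A ≅ ∏ᶜ A := φ.app A
  have hf : ∀ k, Sigma.π A k ≫ Sigma.ι A k ≫ f.hom = f.hom ≫ Pi.π A k ≫ Pi.ι A k :=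
    π_ι_comp_natTrans_app φ.hom A rfl
  have : IsIso ((Sigma.mapIso (diagonalIso f hf)).hom ≫ canonicalHom C I A) := by
    rw [mapIso_diagonalIso_comp_canonicalHom]
    infer_instance
  exact IsIso.of_isIso_comp_left (Sigma.mapIso (diagonalIso f hf)).hom _

/-- For an injection `e : J → I`, the canonical morphism of the constant `J`-indexed family at `X`
is a retract of that of the constant `I`-indexed family. -/
noncomputable def retractArrowCanonicalHom {J : Type*} [DecidableEq J] [HasCoproductsOfShape J C]
    [HasProductsOfShape J C] {e : J → I} (he : Function.Injective e) (X : C) :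
    RetractArrow (canonicalHom C J fun _ => X) (canonicalHom C I fun _ => X) where
  i := Arrow.homMk (Sigma.desc fun n => Sigma.ι (fun _ : I => X) (e n))
    (Pi.lift (Function.extend e (Pi.π fun _ : J => X) 0)) (by
      apply Limits.Sigma.hom_ext
      intro n
      apply Limits.Pi.hom_ext
      intro k
      by_cases hk : ∃ m, e m = k
      · obtain ⟨m, rfl⟩ := hk
        simp [canonicalHom, he.extend_apply, he.eq_iff]
      · have hn : e n ≠ k := fun h => hk ⟨n, h⟩
        simp [canonicalHom, Function.extend_apply' _ _ _ hk, hn])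
  r := Arrow.homMk (Sigma.desc (Function.extend e (Sigma.ι fun _ : J => X) 0))
    (Pi.lift fun n => Pi.π (fun _ : I => X) (e n)) (by
      apply Limits.Sigma.hom_ext
      intro k
      apply Limits.Pi.hom_ext
      intro n
      by_cases hk : ∃ m, e m = k
      · obtain ⟨m, rfl⟩ := hk
        simp [canonicalHom, he.extend_apply, he.eq_iff]
      · have hn : k ≠ e n := fun h => hk ⟨n, h.symm⟩
        simp [canonicalHom, Function.extend_apply' _ _ _ hk, hn])
  retract := by
    apply Arrow.hom_ext
    · apply Limits.Sigma.hom_ext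
      simp [he.extend_apply]
    · apply Limits.Pi.hom_ext
      simp [he.extend_apply]

end

/-- If `I` is infinite, `C` has a zero object and products and coproducts indexed by `I`
(and by `ℕ`), and the coproduct functor `C^I ⥤ C` is naturally isomorphic to the product
functor, then for every object `X` the canonical morphism `∐_{n ∈ ℕ} X ⟶ ∏_{n ∈ ℕ} X`
is an isomorphism. -/
theorem isIso_canonicalHomNat_of_iso [HasZeroObject C] [Infinite I]
    [HasCoproductsOfShape ℕ C] [HasProductsOfShape ℕ C]
    (h : Nonempty (coproductFunctor C I ≅ productFunctor C I)) (X : C) :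
    IsIso (canonicalHomNat C (fun _ : ℕ => X)) := by
  obtain ⟨φ⟩ := h
  have := isIso_canonicalHom_of_iso φ fun _ => X
  exact (MorphismProperty.isomorphisms C).of_retract
    (retractArrowCanonicalHom (Infinite.natEmbedding I).injective X) this
end

section
/- Let C be a category with a zero object, let I be a set with at least two elements, and suppose C has all products and coproducts indexed by I, as well as binary products and coproducts. If the coproduct functor ⨁ : C^I → C and the product functor ∏ : C^I → C are naturally isomorphic, then for any two objects X, Y of C the canonical morphism from the coproduct X ∐ Y to the product X × Y is an isomorphism; consequently C has binary biproducts. -/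
open CategoryTheory CategoryTheory.Limits

universe w v u

variable (C : Type u) [Category.{v} C] (I : Type w)

variable [HasZeroObject C] [HasZeroMorphisms C] [HasBinaryProducts C] [HasBinaryCoproducts C]

/-- The canonical morphism `X ⨿ Y ⟶ X ⨯ Y`, whose matching components are identities and whose
mismatched components are zero. -/
noncomputable def binCanonicalHom (X Y : C) : (X ⨿ Y : C) ⟶ (X ⨯ Y : C) :=
  coprod.desc (prod.lift (𝟙 X) 0) (prod.lift 0 (𝟙 Y))

section SingleIdempotent

variable {D : Type u} [Category.{v} D] [HasZeroMorphisms D] {J : Type w} [DecidableEq J]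

/-- The idempotent endomorphism of a family which is the identity at `i` and zero elsewhere. -/
noncomputable def singleIdempotent (A : J → D) (i : J) : A ⟶ A :=
  fun k => if k = i then 𝟙 (A k) else 0

lemma coproductFunctor_map_singleIdempotent [HasCoproductsOfShape J D] (A : J → D) (i : J) :
    (coproductFunctor D J).map (singleIdempotent A i) = Sigma.π A i ≫ Sigma.ι A i := by
  refine Sigma.hom_ext _ _ fun k => ?_
  by_cases h : k = i
  · subst h
    simp [coproductFunctor, singleIdempotent]
  · simp [coproductFunctor, singleIdempotent, h, Sigma.ι_π_of_ne_assoc A h]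

lemma productFunctor_map_singleIdempotent [HasProductsOfShape J D] (A : J → D) (i : J) :
    (productFunctor D J).map (singleIdempotent A i) = Pi.π A i ≫ Pi.ι A i := by
  refine Pi.hom_ext _ _ fun k => ?_
  by_cases h : k = i
  · subst h
    simp [productFunctor, singleIdempotent]
  · simp [productFunctor, singleIdempotent, h, Pi.ι_π_of_ne A (Ne.symm h)]

variable [HasCoproductsOfShape J D] [HasProductsOfShape J D]

/-- The component at `A` of an isomorphism between the coproduct and product functors. -/
noncomputable def sigmaIsoPi (e : coproductFunctor D J ≅ productFunctor D J) (A : J → D) :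
    ∐ A ≅ ∏ᶜ A :=
  e.app A

/-- The `(i, j)` entry of the morphism `∐ A ⟶ ∏ A` underlying an isomorphism between the
coproduct and product functors. -/
noncomputable def isoEntry (e : coproductFunctor D J ≅ productFunctor D J) (A : J → D)
    (i j : J) : A i ⟶ A j :=
  Sigma.ι A i ≫ (sigmaIsoPi e A).hom ≫ Pi.π A j

lemma π_ι_comp_sigmaIsoPi_hom (e : coproductFunctor D J ≅ productFunctor D J) (A : J → D)
    (i : J) :
    Sigma.π A i ≫ Sigma.ι A i ≫ (sigmaIsoPi e A).hom =
      (sigmaIsoPi e A).hom ≫ Pi.π A i ≫ Pi.ι A i := by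
  have h := e.hom.naturality (singleIdempotent A i)
  rw [coproductFunctor_map_singleIdempotent, productFunctor_map_singleIdempotent] at h
  exact (Category.assoc _ _ _).symm.trans h

lemma ι_comp_sigmaIsoPi_hom (e : coproductFunctor D J ≅ productFunctor D J) (A : J → D)
    (i : J) :
    Sigma.ι A i ≫ (sigmaIsoPi e A).hom = isoEntry e A i i ≫ Pi.ι A i := by
  have h := Sigma.ι A i ≫= π_ι_comp_sigmaIsoPi_hom e A i
  rw [Sigma.ι_π_eq_id_assoc] at h
  simpa only [isoEntry, Category.assoc] using h

lemma isoEntry_of_ne (e : coproductFunctor D J ≅ productFunctor D J) (A : J → D) {i j : J}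
    (hij : i ≠ j) : isoEntry e A i j = 0 := by
  have h := ι_comp_sigmaIsoPi_hom e A i =≫ Pi.π A j
  rwa [Category.assoc, Category.assoc, Pi.ι_π_of_ne A hij, comp_zero] at h

lemma isIso_isoEntry_self (e : coproductFunctor D J ≅ productFunctor D J) (A : J → D) (i : J) :
    IsIso (isoEntry e A i i) := by
  refine ⟨Pi.ι A i ≫ (sigmaIsoPi e A).inv ≫ Sigma.π A i, ?_, ?_⟩
  · have h := ι_comp_sigmaIsoPi_hom e A i =≫ ((sigmaIsoPi e A).inv ≫ Sigma.π A i)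
    rw [Category.assoc, Category.assoc] at h
    rw [← h, Iso.hom_inv_id_assoc, Sigma.ι_π_eq_id]
  · have h := Pi.ι A i ≫= (sigmaIsoPi e A).inv ≫= (π_ι_comp_sigmaIsoPi_hom e A i =≫ Pi.π A i)
    simpa [isoEntry] using h

end SingleIdempotent

section TwoPositions

attribute [local simp] coprod.inl_desc coprod.inr_desc coprod.inl_desc_assoc
  coprod.inr_desc_assoc prod.lift_fst prod.lift_snd prod.lift_fst_assoc prod.lift_snd_assoc

variable {D : Type u} [Category.{v} D] [HasZeroMorphisms D] {J : Type w} [DecidableEq J]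

/-- If a family vanishes away from `i` and `j`, its coproduct is the binary coproduct of its
values at `i` and `j`. -/
lemma isIso_coprod_desc_ι [HasBinaryCoproducts D] [HasCoproductsOfShape J D] (A : J → D)
    {i j : J} (hij : i ≠ j) (hA : ∀ k, k ≠ i → k ≠ j → IsZero (A k)) :
    IsIso (coprod.desc (Sigma.ι A i) (Sigma.ι A j)) := by
  let t : ∐ A ⟶ A i ⨿ A j := Limits.Sigma.desc fun k =>
    if h : k = i then eqToHom (congrArg A h) ≫ coprod.inl
    else if h : k = j then eqToHom (congrArg A h) ≫ coprod.inr else 0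
  have hi : Sigma.ι A i ≫ t = coprod.inl := by simp [t]
  have hj : Sigma.ι A j ≫ t = coprod.inr := by simp [t, hij.symm]
  refine ⟨t, ?_, Sigma.hom_ext _ _ fun k => ?_⟩
  · ext <;> simp [hi, hj]
  · by_cases h : k = i
    · subst h; simp [reassoc_of% hi]
    · by_cases h' : k = j
      · subst h'; simp [reassoc_of% hj]
      · exact (hA k h h').eq_of_src _ _

/-- If a family vanishes away from `i` and `j`, its product is the binary product of its
values at `i` and `j`. -/
lemma isIso_prod_lift_π [HasBinaryProducts D] [HasProductsOfShape J D] (A : J → D)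
    {i j : J} (hij : i ≠ j) (hA : ∀ k, k ≠ i → k ≠ j → IsZero (A k)) :
    IsIso (prod.lift (Pi.π A i) (Pi.π A j)) := by
  let r : A i ⨯ A j ⟶ ∏ᶜ A := Limits.Pi.lift fun k =>
    if h : k = i then prod.fst ≫ eqToHom (congrArg A h.symm)
    else if h : k = j then prod.snd ≫ eqToHom (congrArg A h.symm) else 0
  have hi : r ≫ Pi.π A i = prod.fst := by simp [r]
  have hj : r ≫ Pi.π A j = prod.snd := by simp [r, hij.symm]
  refine ⟨r, Pi.hom_ext _ _ fun k => ?_, ?_⟩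
  · by_cases h : k = i
    · subst h; simp [hi]
    · by_cases h' : k = j
      · subst h'; simp [hj]
      · exact (hA k h h').eq_of_tgt _ _
  · ext <;> simp [hi, hj]

lemma isIso_binCanonicalHom_of_isZero [HasBinaryProducts D] [HasBinaryCoproducts D]
    [HasCoproductsOfShape J D] [HasProductsOfShape J D]
    (e : coproductFunctor D J ≅ productFunctor D J) (A : J → D) {i j : J} (hij : i ≠ j)
    (hA : ∀ k, k ≠ i → k ≠ j → IsZero (A k)) : IsIso (binCanonicalHom D (A i) (A j)) := by
  have := isIso_coprod_desc_ι A hij hA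
  have := isIso_prod_lift_π A hij hA
  have := isIso_isoEntry_self e A i
  have := isIso_isoEntry_self e A j
  let θ := (sigmaIsoPi e A).hom
  have hii : Sigma.ι A i ≫ θ ≫ Pi.π A i = isoEntry e A i i := rfl
  have hjj : Sigma.ι A j ≫ θ ≫ Pi.π A j = isoEntry e A j j := rfl
  have h_ij : Sigma.ι A i ≫ θ ≫ Pi.π A j = 0 := isoEntry_of_ne e A hij
  have h_ji : Sigma.ι A j ≫ θ ≫ Pi.π A i = 0 := isoEntry_of_ne e A hij.symm
  have h : coprod.map (isoEntry e A i i) (isoEntry e A j j) ≫ binCanonicalHom D (A i) (A j) =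
      coprod.desc (Sigma.ι A i) (Sigma.ι A j) ≫ θ ≫ prod.lift (Pi.π A i) (Pi.π A j) := by
    ext <;> simp [binCanonicalHom, hii, hjj, h_ij, h_ji]
  have : IsIso (coprod.map (isoEntry e A i i) (isoEntry e A j j) ≫
      binCanonicalHom D (A i) (A j)) := by
    rw [h]; infer_instance
  exact IsIso.of_isIso_comp_left (coprod.map (isoEntry e A i i) (isoEntry e A j j)) _

lemma hasBinaryBiproduct_of_isIso_binCanonicalHom [HasBinaryProducts D] [HasBinaryCoproducts D]
    (X Y : D) [IsIso (binCanonicalHom D X Y)] :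
    HasBinaryBiproduct X Y := by
  let b : BinaryBicone X Y :=
    { pt := X ⨿ Y
      fst := coprod.desc (𝟙 X) 0
      snd := coprod.desc 0 (𝟙 Y)
      inl := coprod.inl
      inr := coprod.inr }
  have hb : (prodIsProd X Y).lift b.toCone = binCanonicalHom D X Y := by
    refine (prodIsProd X Y).hom_ext ?_
    rintro ⟨_ | _⟩ <;> rw [IsLimit.fac]
    · change coprod.desc (𝟙 X) 0 = binCanonicalHom D X Y ≫ prod.fst
      ext <;> simp [binCanonicalHom]
    · change coprod.desc 0 (𝟙 Y) = binCanonicalHom D X Y ≫ prod.snd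
      ext <;> simp [binCanonicalHom]
  have : IsIso ((prodIsProd X Y).lift b.toCone) := hb ▸ ‹_›
  exact .mk ⟨b, ⟨(prodIsProd X Y).ofPointIso, coprodIsCoprod X Y⟩⟩

end TwoPositions

/-- Let `C` be a category with a zero object and `I` a set with at least two elements such that
`C` has products and coproducts indexed by `I` as well as binary products and coproducts. If the
coproduct and product functors `C^I ⥤ C` are naturally isomorphic, then for all objects `X, Y`
the canonical morphism `X ⨿ Y ⟶ X ⨯ Y` is an isomorphism; consequently `C` has binary
biproducts. -/
theorem isIso_binCanonicalHom_of_iso [Nontrivial I]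
    [HasCoproductsOfShape I C] [HasProductsOfShape I C]
    (h : Nonempty (coproductFunctor C I ≅ productFunctor C I)) :
    (∀ X Y : C, IsIso (binCanonicalHom C X Y)) ∧ HasBinaryBiproducts C := by
  classical
  obtain ⟨e⟩ := h
  obtain ⟨i, j, hij⟩ := exists_pair_ne I
  have key (X Y : C) : IsIso (binCanonicalHom C X Y) := by
    obtain ⟨Z, hZ⟩ := HasZeroObject.zero (C := C)
    obtain ⟨A, rfl, rfl, hA⟩ : ∃ A : I → C, A i = X ∧ A j = Y ∧
        ∀ k, k ≠ i → k ≠ j → IsZero (A k) :=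
      ⟨fun k => if k = i then X else if k = j then Y else Z, by simp, by simp [hij.symm],
        fun k hi hj => by simpa [hi, hj] using hZ⟩
    exact isIso_binCanonicalHom_of_isZero e A hij hA
  exact ⟨key, ⟨fun X Y =>
    have := key X Y
    hasBinaryBiproduct_of_isIso_binCanonicalHom X Y⟩⟩
end

section
/- Let R be a ring and (M_i)_{i∈I} a family of R-modules. Define M_* := (⨁_{n∈ℕ} (⨁_{i∈I} M_i)) × (∏_{n∈ℕ} (∏_{i∈I} M_i)), i.e., the product of a countable direct sum of copies of ⨁_{i∈I} M_i with a countable direct product of copies of ∏_{i∈I} M_i. Then there is an isomorphism of R-modules (⨁_{i∈I} M_i) ⊕ M_* ≅ (∏_{i∈I} M_i) × M_*. In other words, the completed family (M_i)_{i∈I⊔{*}} obtained by adjoining M_* has its direct sum isomorphic to its direct product. -/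
open scoped DirectSum

universe u v w

namespace LinearEquiv

/-- A countable direct sum of copies of `A` absorbs one further copy of `A`. -/
noncomputable def prodDirectSumNat (R A : Type*) [Semiring R] [AddCommMonoid A] [Module R A] :
    (A × (⨁ _ : ℕ, A)) ≃ₗ[R] (⨁ _ : ℕ, A) :=
  (DirectSum.lequivProdDirectSum (α := fun _ : Option ℕ => A) R).symm ≪≫ₗ
    DirectSum.lequivCongrLeft R (Denumerable.eqv (Option ℕ))

/-- A countable direct product of copies of `A` absorbs one further copy of `A`. -/
def prodPiNat (R A : Type*) [Semiring R] [AddCommMonoid A] [Module R A] :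
    (A × (ℕ → A)) ≃ₗ[R] (ℕ → A) :=
  (LinearEquiv.piOptionEquivProd (M := fun _ : Option ℕ => A) R).symm ≪≫ₗ
    LinearEquiv.funCongrLeft R A (Denumerable.eqv (Option ℕ)).symm

end LinearEquiv

/-- For a family `(M_i)_{i ∈ I}` of modules over a ring `R`, let
`M_* = (⨁_{n ∈ ℕ} ⨁_{i ∈ I} M_i) × (∏_{n ∈ ℕ} ∏_{i ∈ I} M_i)`. Then adjoining `M_*` to the
family makes its direct sum isomorphic to its direct product:
`(⨁_{i ∈ I} M_i) ⊕ M_* ≅ (∏_{i ∈ I} M_i) × M_*`. -/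
theorem directSum_prod_completed_family_iso (R : Type u) [Ring R] {I : Type v}
    (M : I → Type w) [∀ i, AddCommGroup (M i)] [∀ i, Module R (M i)] :
    Nonempty (((⨁ i, M i) × ((⨁ _ : ℕ, (⨁ i, M i)) × (∀ _ : ℕ, ∀ i, M i))) ≃ₗ[R]
      ((∀ i, M i) × ((⨁ _ : ℕ, (⨁ i, M i)) × (∀ _ : ℕ, ∀ i, M i)))) := by
  let S := ⨁ _ : ℕ, ⨁ i, M i
  let P := ℕ → ∀ i, M i
  have absorbSum : ((⨁ i, M i) × (S × P)) ≃ₗ[R] (S × P) :=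
    (LinearEquiv.prodAssoc R _ S P).symm ≪≫ₗ
      (LinearEquiv.prodDirectSumNat R _).prodCongr (.refl R P)
  have absorbProd : ((∀ i, M i) × (S × P)) ≃ₗ[R] (S × P) :=
    (LinearEquiv.prodAssoc R _ S P).symm ≪≫ₗ
      (LinearEquiv.prodComm R _ S).prodCongr (.refl R P) ≪≫ₗ
      LinearEquiv.prodAssoc R S _ P ≪≫ₗ
      (LinearEquiv.refl R S).prodCongr (LinearEquiv.prodPiNat R _)
  exact ⟨absorbSum ≪≫ₗ absorbProd.symm⟩
end
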